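/- Let n ≥ 1, let b_1 ≥ b_2 ≥ … ≥ b_n be positive integers with b_1 ≥ 2, and let k ≥ 2 be an integer. Let P = {(x, y, z_1,…,z_n) ∈ ℝ^{n+2} : 0 ≤ x ≤ 1, 0 ≤ y ≤ 1, and max(k b_i x, b_i y) ≤ z_i ≤ min(1 + k b_i x, 1 + b_i y) for all i}. Then the Lebesgue volume of P equals (1/k)·(((2b_1 − 1)/(b_1 − 1))·A + B), where A = (1 − 1/b_1) Σ_{i=1}^{n} (−1)^{i−1} S_{i−1}(b_2,…,b_n)/(i(i+1)b_1^{i}) and B = 2 Σ_{i=1}^{n} (−1)^{i−1} S_{i−1}(b_2,…,b_n)/(i(i+1)(i+2)b_1^{i+1}). (By Von Korff's theorem this volume is the F-signature of the intersection algebra B(k·b, b).) -/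

import Mathlib

open Finset MeasureTheory

/-- `S_j(b_2,…,b_n)`: the elementary symmetric polynomial of degree `j` evaluated at the
tail entries `b_2,…,b_n` (indices `i ≠ 0` of `b : Fin n → ℕ`), as a real number. -/
noncomputable def esymmTail (n : ℕ) (b : Fin n → ℕ) (j : ℕ) : ℝ :=
  (((Finset.univ.filter (fun i : Fin n => (i : ℕ) ≠ 0)).val.map
    (fun i => (b i : ℝ))).esymm j)

/-- `A = (1 - 1/b_1) Σ_{i=1}^n (-1)^{i-1} S_{i-1}(b_2,…,b_n)/(i(i+1)b_1^i)`. -/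
noncomputable def Aval (n : ℕ) (hn : 1 ≤ n) (b : Fin n → ℕ) : ℝ :=
  (1 - 1 / (b ⟨0, hn⟩ : ℝ)) *
    ∑ j ∈ Finset.range n, (-1 : ℝ) ^ j * esymmTail n b j /
      (((j : ℝ) + 1) * ((j : ℝ) + 2) * (b ⟨0, hn⟩ : ℝ) ^ (j + 1))

/-- `B = 2 Σ_{i=1}^n (-1)^{i-1} S_{i-1}(b_2,…,b_n)/(i(i+1)(i+2)b_1^{i+1})`. -/
noncomputable def Bval (n : ℕ) (hn : 1 ≤ n) (b : Fin n → ℕ) : ℝ :=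
  2 * ∑ j ∈ Finset.range n, (-1 : ℝ) ^ j * esymmTail n b j /
      (((j : ℝ) + 1) * ((j : ℝ) + 2) * ((j : ℝ) + 3) * (b ⟨0, hn⟩ : ℝ) ^ (j + 2))

theorem prod_one_sub_mul_eq_sum_esymm {ι : Type*} (s : Finset ι) (f : ι → ℝ) (t : ℝ) :
    ∏ i ∈ s, (1 - f i * t) =
      ∑ j ∈ range (s.card + 1), (-1) ^ j * (s.val.map f).esymm j * t ^ j := by
  have h : ∀ i ∈ s, 1 - f i * t = 1 + (-t) * f i := fun i _ => by ring
  classical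
  rw [prod_congr rfl h, prod_one_add, sum_powerset]
  refine sum_congr rfl fun j _ => ?_
  rw [esymm_map_val, mul_sum, sum_mul]
  refine sum_congr rfl fun u hu => ?_
  rw [prod_mul_distrib, prod_const, (mem_powersetCard.1 hu).2, neg_pow]
  ring

theorem prod_one_sub_mul_tail (n : ℕ) (hn : 1 ≤ n) (b : Fin n → ℕ) (t : ℝ) :
    ∏ i, (1 - (b i : ℝ) * t) =
      (1 - b ⟨0, hn⟩ * t) * ∑ j ∈ range n, (-1) ^ j * esymmTail n b j * t ^ j := by
  have hs : univ.filter (fun i : Fin n => (i : ℕ) ≠ 0) = univ.erase ⟨0, hn⟩ := by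
    ext i; simp [Fin.ext_iff]
  have hc : (univ.erase (⟨0, hn⟩ : Fin n)).card + 1 = n := by
    rw [card_erase_of_mem (mem_univ _), card_univ, Fintype.card_fin]; omega
  have h := prod_one_sub_mul_eq_sum_esymm (univ.erase (⟨0, hn⟩ : Fin n)) (fun i => (b i : ℝ)) t
  rw [hc] at h
  rw [← mul_prod_erase univ _ (mem_univ (⟨0, hn⟩ : Fin n)), h]
  simp only [esymmTail, hs]

theorem integral_two_sub_mul_one_sub_mul_pow {c : ℝ} (hc : c ≠ 0) (j : ℕ) :
    ∫ t in (0 : ℝ)..c⁻¹, (2 - t) * ((1 - c * t) * t ^ j) =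
      (2 - c⁻¹) / ((j + 1) * (j + 2) * c ^ (j + 1)) +
        2 / ((j + 1) * (j + 2) * (j + 3) * c ^ (j + 2)) := by
  have h : ∀ t : ℝ, (2 - t) * ((1 - c * t) * t ^ j) =
      2 * t ^ j - (2 * c + 1) * t ^ (j + 1) + c * t ^ (j + 2) := fun t => by ring
  simp_rw [h]
  rw [intervalIntegral.integral_add, intervalIntegral.integral_sub]
  · simp only [intervalIntegral.integral_const_mul, integral_pow]
    have h1 : (j : ℝ) + 1 ≠ 0 := by positivity
    have h2 : (j : ℝ) + 2 ≠ 0 := by positivity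
    have h3 : (j : ℝ) + 3 ≠ 0 := by positivity
    have h2' : (j : ℝ) + 1 + 1 ≠ 0 := by positivity
    have h3' : (j : ℝ) + 2 + 1 ≠ 0 := by positivity
    push_cast
    simp only [inv_pow, ne_eq, Nat.add_eq_zero_iff, one_ne_zero, and_false, not_false_eq_true,
      zero_pow, OfNat.ofNat_ne_zero, sub_zero]
    field_simp
    ring
  all_goals exact Continuous.intervalIntegrable (by fun_prop) _ _

theorem integral_two_sub_mul_prod (n : ℕ) (hn : 1 ≤ n) (b : Fin n → ℕ)
    (hb1 : 2 ≤ b ⟨0, hn⟩) :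
    ∫ t in (0 : ℝ)..(b ⟨0, hn⟩ : ℝ)⁻¹, (2 - t) * ∏ i, (1 - (b i : ℝ) * t) =
      ((2 * (b ⟨0, hn⟩ : ℝ) - 1) / ((b ⟨0, hn⟩ : ℝ) - 1)) * Aval n hn b + Bval n hn b := by
  have hb2 : (2 : ℝ) ≤ b ⟨0, hn⟩ := by exact_mod_cast hb1
  simp_rw [prod_one_sub_mul_tail n hn b, Aval, Bval]
  generalize (b ⟨0, hn⟩ : ℝ) = c at hb2
  have hc : c ≠ 0 := by linarith
  have hc1 : c - 1 ≠ 0 := by linarith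
  have h : ∀ t : ℝ,
      (2 - t) * ((1 - c * t) * ∑ j ∈ range n, (-1) ^ j * esymmTail n b j * t ^ j) =
      ∑ j ∈ range n, ((-1) ^ j * esymmTail n b j) * ((2 - t) * ((1 - c * t) * t ^ j)) := by
    intro t
    simp_rw [mul_sum]
    exact sum_congr rfl fun j _ => by ring
  simp_rw [h]
  rw [intervalIntegral.integral_finsetSum
    fun j _ => Continuous.intervalIntegrable (by fun_prop) _ _]
  simp_rw [intervalIntegral.integral_const_mul, integral_two_sub_mul_one_sub_mul_pow hc]
  have hq : (2 * c - 1) / (c - 1) * (1 - 1 / c) = 2 - c⁻¹ := by field_simp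
  rw [← mul_assoc, hq, mul_sum, mul_sum, ← sum_add_distrib]
  exact sum_congr rfl fun j _ => by ring

/-- The convolution-type identity behind the volume computation: the mass of an even function
supported near the diagonal strip `k x = y` of the unit square. -/
theorem integral_integral_comp_mul_sub_of_even {h : ℝ → ℝ} (hcont : Continuous h)
    (heven : ∀ t, h (-t) = h t) {c : ℝ} (hc1 : c ≤ 1)
    (hsupp : ∀ t, c ≤ t → h t = 0) {k : ℝ} (hk : 2 ≤ k) :
    ∫ y in (0 : ℝ)..1, ∫ x in (0 : ℝ)..1, h (k * x - y) =
      1 / k * ∫ t in (0 : ℝ)..c, (2 - t) * h t := by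
  have hi : ∀ u v, IntervalIntegrable h volume u v := fun u v => hcont.intervalIntegrable u v
  have htail : ∀ {g : ℝ → ℝ}, Continuous g → (∀ t, c ≤ t → g t = 0) → ∀ {u : ℝ}, c ≤ u →
      ∫ t in (0 : ℝ)..u, g t = ∫ t in (0 : ℝ)..c, g t := by
    intro g hg hg0 u hu
    rw [← intervalIntegral.integral_add_adjacent_intervals
      (hg.intervalIntegrable 0 c) (hg.intervalIntegrable c u)]
    have : ∫ t in c..u, g t = ∫ t in c..u, (0 : ℝ) :=
      intervalIntegral.integral_congr fun t ht => by
        rw [Set.uIcc_of_le hu] at ht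
        exact hg0 t ht.1
    simp [this]
  have hinner : ∀ y ∈ Set.uIcc (0 : ℝ) 1, ∫ x in (0 : ℝ)..1, h (k * x - y) =
      k⁻¹ * ((∫ t in (0 : ℝ)..y, h t) + ∫ t in (0 : ℝ)..1, h t) := by
    intro y hy
    rw [Set.uIcc_of_le zero_le_one] at hy
    rw [intervalIntegral.integral_comp_mul_sub _ (by linarith : k ≠ 0), smul_eq_mul,
      ← intervalIntegral.integral_add_adjacent_intervals (hi _ 0) (hi 0 _),
      htail hcont hsupp (by linarith [hy.2] : c ≤ k * 1 - y), htail hcont hsupp hc1]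
    congr 2
    have := intervalIntegral.integral_comp_neg (a := 0) (b := y) h
    simp only [heven, neg_zero] at this
    simpa using this.symm
  have hparts : ∫ y in (0 : ℝ)..1, ∫ t in (0 : ℝ)..y, h t =
      (∫ t in (0 : ℝ)..1, h t) - ∫ t in (0 : ℝ)..1, t * h t := by
    have := intervalIntegral.integral_mul_deriv_eq_deriv_mul
      (a := 0) (b := 1) (u := fun y => ∫ t in (0 : ℝ)..y, h t) (v := fun y => y)
      (u' := h) (v' := fun _ => 1)
      (fun x _ => intervalIntegral.integral_hasDerivAt_right (hi 0 x)
        (hcont.stronglyMeasurableAtFilter _ _) hcont.continuousAt)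
      (fun x _ => hasDerivAt_id x) (hi 0 1) (continuous_const.intervalIntegrable _ _)
    simpa [mul_comm] using this
  rw [intervalIntegral.integral_congr hinner, intervalIntegral.integral_const_mul,
    intervalIntegral.integral_add
      ((intervalIntegral.continuous_primitive hi 0).intervalIntegrable _ _)
      (continuous_const.intervalIntegrable _ _), hparts,
    ← htail (g := fun t => (2 - t) * h t) (by fun_prop) (fun t ht => by simp [hsupp t ht]) hc1]
  simp_rw [sub_mul]
  rw [intervalIntegral.integral_sub (Continuous.intervalIntegrable (by fun_prop) _ _)
    (Continuous.intervalIntegrable (by fun_prop) _ _), intervalIntegral.integral_const_mul]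
  simp only [intervalIntegral.integral_const, smul_eq_mul]
  ring

theorem volume_eq_lintegral_volume_cons {n : ℕ} {S : Set (Fin (n + 1) → ℝ)}
    (hS : MeasurableSet S) :
    volume S = ∫⁻ x : ℝ, volume {q : Fin n → ℝ | (Fin.cons x q : Fin (n + 1) → ℝ) ∈ S} := by
  have hmp := (volume_preserving_piFinSuccAbove (fun _ : Fin (n + 1) => ℝ) 0).symm
  rw [← hmp.measure_preimage hS.nullMeasurableSet, Measure.volume_eq_prod,
    Measure.prod_apply (hmp.measurable hS)]
  refine lintegral_congr fun x => congrArg _ ?_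
  ext q
  simp [MeasurableEquiv.piFinSuccAbove, Fin.consEquiv]

theorem min_sub_max_eq_one_sub_abs (u v : ℝ) : min (1 + u) (1 + v) - max u v = 1 - |u - v| := by
  rcases le_total u v with h | h
  · rw [min_eq_left (by linarith), max_eq_right h, abs_of_nonpos (by linarith)]; ring
  · rw [min_eq_right (by linarith), max_eq_left h, abs_of_nonneg (by linarith)]; ring

/-- The region over the unit square has, over `(x, y)`, a box of sides `(1 - bᵢ |k x - y|)₊`. -/
theorem volume_region_eq_integral (n : ℕ) (b : Fin n → ℕ) (k : ℕ) :
    volume {p : Fin (n + 2) → ℝ | 0 ≤ p 0 ∧ p 0 ≤ 1 ∧ 0 ≤ p 1 ∧ p 1 ≤ 1 ∧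
      ∀ i : Fin n,
        max ((k : ℝ) * (b i : ℝ) * p 0) ((b i : ℝ) * p 1) ≤ p i.succ.succ ∧
        p i.succ.succ ≤ min (1 + (k : ℝ) * (b i : ℝ) * p 0) (1 + (b i : ℝ) * p 1)} =
      ENNReal.ofReal (∫ y in (0 : ℝ)..1, ∫ x in (0 : ℝ)..1,
        ∏ i, max (1 - (b i : ℝ) * |k * x - y|) 0) := by
  set F : ℝ → ℝ → ℝ := fun x y => ∏ i, max (1 - (b i : ℝ) * |k * x - y|) 0 with hF
  have hFc : Continuous (Function.uncurry F) := by
    simp only [hF, Function.uncurry_def]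
    fun_prop
  have hF0 : ∀ x y, 0 ≤ F x y := fun x y => prod_nonneg fun i _ => le_max_right _ _
  set P := {p : Fin (n + 2) → ℝ | 0 ≤ p 0 ∧ p 0 ≤ 1 ∧ 0 ≤ p 1 ∧ p 1 ≤ 1 ∧
      ∀ i : Fin n,
        max ((k : ℝ) * (b i : ℝ) * p 0) ((b i : ℝ) * p 1) ≤ p i.succ.succ ∧
        p i.succ.succ ≤ min (1 + (k : ℝ) * (b i : ℝ) * p 0) (1 + (b i : ℝ) * p 1)} with hP
  have hPc : IsClosed P := by
    simp only [hP, Set.ofPred_and, Set.ofPred_forall]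
    refine IsClosed.inter ?_ (IsClosed.inter ?_ (IsClosed.inter ?_ (IsClosed.inter ?_
      (isClosed_iInter fun i => IsClosed.inter ?_ ?_)))) <;>
    exact isClosed_le (by fun_prop) (by fun_prop)
  have hslice : ∀ x y : ℝ,
      volume {z : Fin n → ℝ | (Fin.cons x (Fin.cons y z : Fin (n + 1) → ℝ) : Fin (n + 2) → ℝ) ∈ P} =
        (Set.Icc (0 : ℝ) 1).indicator
          (fun x => (Set.Icc (0 : ℝ) 1).indicator (fun y => ENNReal.ofReal (F x y)) y) x := by
    intro x y
    by_cases hx : x ∈ Set.Icc (0 : ℝ) 1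
    · by_cases hy : y ∈ Set.Icc (0 : ℝ) 1
      · rw [Set.indicator_of_mem hx, Set.indicator_of_mem hy]
        have : {z : Fin n → ℝ |
            (Fin.cons x (Fin.cons y z : Fin (n + 1) → ℝ) : Fin (n + 2) → ℝ) ∈ P} =
            Set.Icc (fun i => max ((k : ℝ) * (b i : ℝ) * x) ((b i : ℝ) * y))
              (fun i => min (1 + (k : ℝ) * (b i : ℝ) * x) (1 + (b i : ℝ) * y)) := by
          ext z
          have h1 : (Fin.cons x (Fin.cons y z : Fin (n + 1) → ℝ) : Fin (n + 2) → ℝ) 1 = y := rfl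
          simp only [hP, Set.mem_ofPred_eq, Fin.cons_zero, h1, Fin.cons_succ, hx.1, hx.2, hy.1,
            hy.2, true_and, Set.mem_Icc, Pi.le_def, forall_and]
        rw [this, Real.volume_Icc_pi, hF, ENNReal.ofReal_prod_of_nonneg fun i _ => le_max_right _ _]
        refine prod_congr rfl fun i _ => ?_
        rw [min_sub_max_eq_one_sub_abs, ENNReal.ofReal_max, ENNReal.ofReal_zero,
          max_eq_left zero_le, ← abs_of_nonneg (Nat.cast_nonneg (α := ℝ) (b i)), ← abs_mul,
          abs_of_nonneg (Nat.cast_nonneg (α := ℝ) (b i))]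
        ring_nf
      · rw [Set.indicator_of_mem hx, Set.indicator_of_notMem hy]
        convert measure_empty (μ := volume) using 2
        exact Set.eq_empty_of_forall_notMem fun z hz => hy ⟨hz.2.2.1, hz.2.2.2.1⟩
    · rw [Set.indicator_of_notMem hx]
      convert measure_empty (μ := volume) using 2
      exact Set.eq_empty_of_forall_notMem fun z hz => hx ⟨hz.1, hz.2.1⟩
  have hvol : volume P = ∫⁻ x in Set.Icc (0 : ℝ) 1, ∫⁻ y in Set.Icc (0 : ℝ) 1,
      ENNReal.ofReal (F x y) := by
    rw [volume_eq_lintegral_volume_cons hPc.measurableSet,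
      ← lintegral_indicator measurableSet_Icc]
    refine lintegral_congr fun x => ?_
    have hm : Continuous fun q : Fin (n + 1) → ℝ => (Fin.cons x q : Fin (n + 2) → ℝ) := by
      fun_prop
    refine (volume_eq_lintegral_volume_cons (hPc.preimage hm).measurableSet).trans ?_
    simp only [Set.mem_preimage, hslice]
    by_cases hx : x ∈ Set.Icc (0 : ℝ) 1
    · simp only [Set.indicator_of_mem hx]
      rw [lintegral_indicator measurableSet_Icc]
    · simp only [Set.indicator_of_notMem hx, lintegral_zero]
  have hinner : ∀ y, ∫⁻ x in Set.Icc (0 : ℝ) 1, ENNReal.ofReal (F x y) =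
      ENNReal.ofReal (∫ x in (0 : ℝ)..1, F x y) := by
    intro y
    have hc : Continuous fun x => F x y := hFc.comp (by fun_prop : Continuous fun x => (x, y))
    rw [intervalIntegral.integral_of_le zero_le_one, ← integral_Icc_eq_integral_Ioc,
      ofReal_integral_eq_lintegral_ofReal (hc.integrableOn_Icc)
        (Filter.Eventually.of_forall fun x => hF0 x y)]
  have hc : Continuous fun y => ∫ x in (0 : ℝ)..1, F x y :=
    intervalIntegral.continuous_parametric_intervalIntegral_of_continuous'
      (f := fun y x => F x y) (hFc.comp continuous_swap) 0 1
  rw [hvol, lintegral_lintegral_swap hFc.measurable.ennreal_ofReal.aemeasurable]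
  simp_rw [hinner]
  rw [intervalIntegral.integral_of_le zero_le_one, ← integral_Icc_eq_integral_Ioc,
    ofReal_integral_eq_lintegral_ofReal (hc.integrableOn_Icc)
      (Filter.Eventually.of_forall fun y =>
        intervalIntegral.integral_nonneg zero_le_one fun x _ => hF0 x y)]

/-- for `b_1 ≥ … ≥ b_n ≥ 1` with `b_1 ≥ 2` and an integer `k ≥ 2`, the volume
of `P = {(x,y,z_1,…,z_n) : 0 ≤ x,y ≤ 1, max(k bᵢ x, bᵢ y) ≤ zᵢ ≤ min(1 + k bᵢ x, 1 + bᵢ y)}`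
equals `(1/k)((2b_1-1)/(b_1-1) · A + B)`; by Von Korff's theorem this is the F-signature of
the intersection algebra `B(k·b, b)`. -/
theorem volume_Fsignature_region_kb (n : ℕ) (hn : 1 ≤ n) (b : Fin n → ℕ)
    (hb : ∀ i, 0 < b i) (hmono : ∀ i j : Fin n, i ≤ j → b j ≤ b i)
    (hb1 : 2 ≤ b ⟨0, hn⟩) (k : ℕ) (hk : 2 ≤ k)
    (P : Set (Fin (n + 2) → ℝ))
    (hP : P = {p | 0 ≤ p 0 ∧ p 0 ≤ 1 ∧ 0 ≤ p 1 ∧ p 1 ≤ 1 ∧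
      ∀ i : Fin n,
        max ((k : ℝ) * (b i : ℝ) * p 0) ((b i : ℝ) * p 1) ≤ p i.succ.succ ∧
        p i.succ.succ ≤ min (1 + (k : ℝ) * (b i : ℝ) * p 0) (1 + (b i : ℝ) * p 1)}) :
    volume P = ENNReal.ofReal ((1 / (k : ℝ)) *
      (((2 * (b ⟨0, hn⟩ : ℝ) - 1) / ((b ⟨0, hn⟩ : ℝ) - 1)) * Aval n hn b + Bval n hn b)) := by
  have hmax : ∀ i, b i ≤ b ⟨0, hn⟩ := fun i => hmono _ _ (Nat.zero_le i)
  have hb2 : (2 : ℝ) ≤ b ⟨0, hn⟩ := by exact_mod_cast hb1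
  have hpos : (0 : ℝ) < b ⟨0, hn⟩ := by linarith
  rw [hP, volume_region_eq_integral, ← integral_two_sub_mul_prod n hn b hb1,
    integral_integral_comp_mul_sub_of_even
      (h := fun t => ∏ i, max (1 - (b i : ℝ) * |t|) 0) (c := (b ⟨0, hn⟩ : ℝ)⁻¹)
      (by fun_prop) (fun t => by simp only [abs_neg])
      (inv_le_one_of_one_le₀ (by linarith)) ?_ (by exact_mod_cast hk)]
  · congr 2
    refine intervalIntegral.integral_congr fun t ht => ?_
    rw [Set.uIcc_of_le (by positivity)] at ht
    congr 1
    refine prod_congr rfl fun i _ => ?_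
    rw [abs_of_nonneg ht.1, max_eq_left]
    have h1 : (b i : ℝ) * t ≤ b ⟨0, hn⟩ * (b ⟨0, hn⟩ : ℝ)⁻¹ :=
      mul_le_mul (by exact_mod_cast hmax i) ht.2 ht.1 hpos.le
    rw [mul_inv_cancel₀ hpos.ne'] at h1
    linarith
  · intro t ht
    refine prod_eq_zero (mem_univ ⟨0, hn⟩) (max_eq_right ?_)
    have h1 := mul_le_mul_of_nonneg_left (ht.trans (le_abs_self t)) hpos.le
    rw [mul_inv_cancel₀ hpos.ne'] at h1
    linarith
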